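/- Let p ∈ [0, n), δ ∈ [0, ∞), and let Ω ⊂ ℝⁿ (n ≥ 2) be a bounded open convex set. Let u, v be continuous on the closure of Ω and twice continuously differentiable in Ω, and assume: (a) v is convex in Ω, v < 0 in Ω, v ≤ 0 on ∂Ω, and det D²v(x) ≥ (|v(x)| + δ)^p for all x ∈ Ω; (b) u ≥ 0 on ∂Ω and det D²u(x) ≤ (|u(x)| + δ)^p for all x ∈ Ω. Then u ≥ v in Ω. -/

import Mathlib

open Metric MeasureTheory Real

/-- The Hessian matrix of `u : ℝⁿ → ℝ` at `x`, with entries the second partial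
derivatives `∂²u/∂xᵢ∂xⱼ` computed via iterated Fréchet derivatives. -/
noncomputable def hessianMatrix {n : ℕ} (u : EuclideanSpace ℝ (Fin n) → ℝ)
    (x : EuclideanSpace ℝ (Fin n)) : Matrix (Fin n) (Fin n) ℝ :=
  Matrix.of fun i j =>
    fderiv ℝ (fun y => fderiv ℝ u y (EuclideanSpace.single j 1)) x (EuclideanSpace.single i 1)

/-- The determinant of the Hessian matrix, `det D²u(x)`. -/
noncomputable def hessianDet {n : ℕ} (u : EuclideanSpace ℝ (Fin n) → ℝ)
    (x : EuclideanSpace ℝ (Fin n)) : ℝ := (hessianMatrix u x).det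

open Matrix Filter Topology

/-- A symmetric matrix dominating the identity has determinant at least one. -/
lemma one_le_det_one_add_of_posSemidef {ι : Type*} [Fintype ι] [DecidableEq ι]
    {P : Matrix ι ι ℝ} (hP : P.PosSemidef) : 1 ≤ (1 + P).det := by
  have hH : (1 + P).IsHermitian := (PosSemidef.one.add hP).isHermitian
  rw [hH.det_eq_prod_eigenvalues]
  refine Finset.one_le_prod fun i _ => ?_
  have hv : star (hH.eigenvectorBasis i).ofLp ⬝ᵥ (hH.eigenvectorBasis i).ofLp = 1 := by
    have h1 := hH.eigenvectorBasis.orthonormal.1 i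
    have h2 := real_inner_self_eq_norm_sq (hH.eigenvectorBasis i)
    rw [h1, EuclideanSpace.inner_eq_star_dotProduct] at h2
    rw [dotProduct_comm, h2]; norm_num
  have h0 := hP.dotProduct_mulVec_nonneg (hH.eigenvectorBasis i).ofLp
  rw [hH.eigenvalues_eq, add_mulVec, one_mulVec, dotProduct_add, hv]
  simpa using h0

/-- Monotonicity of the determinant above a positive definite matrix. -/
lemma det_le_det_of_posDef_of_sub_posSemidef {ι : Type*} [Fintype ι] [DecidableEq ι]
    {K H : Matrix ι ι ℝ} (hK : K.PosDef) (hHK : (H - K).PosSemidef) : K.det ≤ H.det := by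
  obtain ⟨B, hB⟩ : ∃ B : Matrix ι ι ℝ, H - K = Bᴴ * B := by
    open scoped MatrixOrder in
    exact CStarAlgebra.nonneg_iff_eq_star_mul_self.mp hHK.nonneg
  have hH : H = K + Bᴴ * B := by rw [← hB]; abel
  rw [hH, det_add_mul _ _ hK.det_pos.ne'.isUnit]
  exact le_mul_of_one_le_right hK.det_pos.le <| one_le_det_one_add_of_posSemidef <|
    hK.inv.posSemidef.mul_mul_conjTranspose_same B

/-- The second-order necessary condition at a local minimum on the real line. -/
lemma IsLocalMin.deriv_deriv_nonneg {f : ℝ → ℝ} {a : ℝ} (hf : IsLocalMin f a)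
    (hc : ContinuousAt f a) : 0 ≤ deriv (deriv f) a := by
  by_contra! h
  have hmax := isLocalMax_of_deriv_deriv_neg h hf.deriv_eq_zero hc
  have heq : f =ᶠ[𝓝 a] fun _ => f a := by
    filter_upwards [hf, hmax] with x h1 h2 using le_antisymm h2 h1
  have h2 := heq.deriv.deriv_eq
  simp at h2
  exact h.ne h2

section Line

variable {E : Type*} [NormedAddCommGroup E] [NormedSpace ℝ E] {f : E → ℝ} {x : E}

lemma ContDiffAt.eventually_hasDerivAt_line (hf : ContDiffAt ℝ 2 f x) (w : E) :
    ∀ᶠ τ : ℝ in 𝓝 0, HasDerivAt (fun τ : ℝ => f (x + τ • w)) (fderiv ℝ f (x + τ • w) w) τ := by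
  have hc : Tendsto (fun τ : ℝ => x + τ • w) (𝓝 0) (𝓝 x) := by
    have : Continuous fun τ : ℝ => x + τ • w := by fun_prop
    simpa using this.tendsto 0
  filter_upwards [hc.eventually (hf.eventually (by simp))] with τ hτ
  have hl : HasDerivAt (fun τ : ℝ => x + τ • w) w τ := by
    simpa using ((hasDerivAt_id τ).smul_const w).const_add x
  exact (hτ.differentiableAt (by simp)).hasFDerivAt.comp_hasDerivAt τ hl

lemma ContDiffAt.hasDerivAt_deriv_line (hf : ContDiffAt ℝ 2 f x) (w : E) :
    HasDerivAt (deriv fun τ : ℝ => f (x + τ • w)) (fderiv ℝ (fderiv ℝ f) x w w) 0 := by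
  have hl : HasDerivAt (fun τ : ℝ => x + τ • w) w 0 := by
    simpa using ((hasDerivAt_id (0 : ℝ)).smul_const w).const_add x
  have hd : DifferentiableAt ℝ (fderiv ℝ f) x :=
    (hf.fderiv_right (m := 1) (by norm_num)).differentiableAt (by simp)
  have h1 : HasFDerivAt (fderiv ℝ f) (fderiv ℝ (fderiv ℝ f) x) (x + (0 : ℝ) • w) := by
    simpa using hd.hasFDerivAt
  have h2 : HasDerivAt (fun τ : ℝ => fderiv ℝ f (x + τ • w) w)
      (fderiv ℝ (fderiv ℝ f) x w w) 0 := by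
    have h3 : HasDerivAt (fun τ : ℝ => fderiv ℝ f (x + τ • w)) (fderiv ℝ (fderiv ℝ f) x w) 0 :=
      h1.comp_hasDerivAt 0 hl
    simpa using h3.clm_apply (hasDerivAt_const (0 : ℝ) w)
  exact h2.congr_of_eventuallyEq
    ((hf.eventually_hasDerivAt_line w).mono fun τ hτ => hτ.deriv)

/-- Comparison of second derivatives when a linear combination of two functions, restricted to
lines through different base points, has a local minimum. -/
lemma IsLocalMin.fderiv_fderiv_apply_nonneg {g : E → ℝ} {y : E} (hf : ContDiffAt ℝ 2 f x)
    (hg : ContDiffAt ℝ 2 g y) (w z : E) (c : ℝ)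
    (hmin : IsLocalMin (fun τ : ℝ => f (x + τ • w) + c * g (y + τ • z)) 0) :
    0 ≤ fderiv ℝ (fderiv ℝ f) x w w + c * fderiv ℝ (fderiv ℝ g) y z z := by
  have hF := hf.eventually_hasDerivAt_line w
  have hG := hg.eventually_hasDerivAt_line z
  have hd : deriv (fun τ : ℝ => f (x + τ • w) + c * g (y + τ • z)) =ᶠ[𝓝 0]
      fun τ => deriv (fun τ : ℝ => f (x + τ • w)) τ
        + c * deriv (fun τ : ℝ => g (y + τ • z)) τ := by
    filter_upwards [hF, hG] with τ h1 h2
    rw [h1.deriv, h2.deriv]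
    exact (h1.add (h2.const_mul c)).deriv
  have h2 := ((hf.hasDerivAt_deriv_line w).add
    ((hg.hasDerivAt_deriv_line z).const_mul c)).congr_of_eventuallyEq hd
  rw [← h2.deriv]
  exact hmin.deriv_deriv_nonneg
    (hF.self_of_nhds.add (hG.self_of_nhds.const_mul c)).continuousAt

/-- A `C²` convex function has nonnegative second derivatives. -/
lemma ConvexOn.fderiv_fderiv_apply_nonneg {s : Set E} (hs : IsOpen s) (hx : x ∈ s)
    (hconv : ConvexOn ℝ s f) (hf : ContDiffAt ℝ 2 f x) (w : E) :
    0 ≤ fderiv ℝ (fderiv ℝ f) x w w := by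
  have hmem : ∀ z : E, ∀ᶠ τ : ℝ in 𝓝 0, x + τ • z ∈ s := fun z => by
    have : Continuous fun τ : ℝ => x + τ • z := by fun_prop
    exact this.continuousAt.eventually (by simpa using hs.mem_nhds hx)
  have hmin : IsLocalMin (fun τ : ℝ => f (x + τ • w) + 1 * f (x + τ • (-w))) 0 := by
    filter_upwards [hmem w, hmem (-w)] with τ h1 h2
    have h := hconv.2 h1 h2 one_half_pos.le one_half_pos.le (add_halves (1 : ℝ))
    have he : (1 / 2 : ℝ) • (x + τ • w) + (1 / 2 : ℝ) • (x + τ • (-w)) = x := by module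
    rw [he] at h
    simp only [smul_eq_mul] at h
    simp only [zero_smul, add_zero]
    linarith
  have h := hmin.fderiv_fderiv_apply_nonneg hf hf
  simp only [map_neg, _root_.neg_apply] at h
  linarith

end Line

section Hessian

variable {n : ℕ} {f : EuclideanSpace ℝ (Fin n) → ℝ} {x : EuclideanSpace ℝ (Fin n)}

lemma hessianMatrix_apply (hf : ContDiffAt ℝ 2 f x) (i j : Fin n) :
    hessianMatrix f x i j = fderiv ℝ (fderiv ℝ f) x (EuclideanSpace.single i 1)
      (EuclideanSpace.single j 1) := by
  have hd : DifferentiableAt ℝ (fderiv ℝ f) x :=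
    (hf.fderiv_right (m := 1) (by norm_num)).differentiableAt (by simp)
  simp [hessianMatrix, fderiv_clm_apply hd (differentiableAt_const _)]

lemma hessianMatrix_isHermitian (hf : ContDiffAt ℝ 2 f x) : (hessianMatrix f x).IsHermitian := by
  ext i j
  rw [conjTranspose_apply, star_trivial, hessianMatrix_apply hf, hessianMatrix_apply hf]
  exact hf.isSymmSndFDerivAt (by simp) _ _

lemma dotProduct_hessianMatrix_mulVec (hf : ContDiffAt ℝ 2 f x) (w : EuclideanSpace ℝ (Fin n)) :
    w.ofLp ⬝ᵥ (hessianMatrix f x *ᵥ w.ofLp) = fderiv ℝ (fderiv ℝ f) x w w := by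
  have hw : w = ∑ i, w i • EuclideanSpace.single i (1 : ℝ) := by
    simpa using ((EuclideanSpace.basisFun (Fin n) ℝ).sum_repr w).symm
  conv_rhs => rw [hw]
  simp only [map_sum, map_smul, _root_.sum_apply, _root_.smul_apply,
    dotProduct, mulVec, hessianMatrix_apply hf, smul_eq_mul, Finset.mul_sum]
  rw [Finset.sum_comm]
  exact Finset.sum_congr rfl fun i _ => Finset.sum_congr rfl fun j _ => by ring

lemma ConvexOn.posSemidef_hessianMatrix {s : Set (EuclideanSpace ℝ (Fin n))} (hs : IsOpen s)
    (hx : x ∈ s) (hconv : ConvexOn ℝ s f) (hf : ContDiffAt ℝ 2 f x) :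
    (hessianMatrix f x).PosSemidef := by
  refine .of_dotProduct_mulVec_nonneg (hessianMatrix_isHermitian hf) fun w => ?_
  have h := dotProduct_hessianMatrix_mulVec hf (WithLp.toLp 2 w)
  rw [star_trivial, h]
  exact hconv.fderiv_fderiv_apply_nonneg hs hx hf _

end Hessian

/-- Comparison principle for degenerate subcritical Monge–Ampère
equations `det D²w = (|w|+δ)^p`, `0 ≤ p < n`. The supersolution `u` need not be convex. -/
theorem stmt_5 (n : ℕ) (hn : 2 ≤ n) (p δ : ℝ)
    (hp0 : 0 ≤ p) (hpn : p < (n : ℝ)) (hδ : 0 ≤ δ)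
    (Ω : Set (EuclideanSpace ℝ (Fin n)))
    (hΩo : IsOpen Ω) (hΩb : Bornology.IsBounded Ω) (hΩc : Convex ℝ Ω)
    (u v : EuclideanSpace ℝ (Fin n) → ℝ)
    (hu_cont : ContinuousOn u (closure Ω)) (hu2 : ContDiffOn ℝ 2 u Ω)
    (hv_cont : ContinuousOn v (closure Ω)) (hv2 : ContDiffOn ℝ 2 v Ω)
    (hvconv : ConvexOn ℝ Ω v)
    (hvneg : ∀ x ∈ Ω, v x < 0)
    (hvbd : ∀ x ∈ frontier Ω, v x ≤ 0)
    (hvsub : ∀ x ∈ Ω, hessianDet v x ≥ (|v x| + δ) ^ p)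
    (hubd : ∀ x ∈ frontier Ω, 0 ≤ u x)
    (husup : ∀ x ∈ Ω, hessianDet u x ≤ (|u x| + δ) ^ p) :
    ∀ x ∈ Ω, v x ≤ u x := by
  intro x₀ hx₀
  by_contra! hlt
  have hv₀ := hvneg x₀ hx₀
  have hn0 : n ≠ 0 := by omega
  set ρ : ℝ := u x₀ / v x₀ with hρ
  have hρ1 : 1 < ρ := by rwa [hρ, one_lt_div_of_neg hv₀]
  have hgap : 1 < ρ ^ ((n : ℝ) - p) := Real.one_lt_rpow hρ1 (by linarith)
  -- a dilation factor so close to one that it does not absorb the gap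
  obtain ⟨t, ⟨ht0, ht1⟩, htgap⟩ :
      ∃ t ∈ Set.Ioo (0 : ℝ) 1, 1 < (t ^ 2) ^ n * ρ ^ ((n : ℝ) - p) := by
    have hc : ContinuousAt (fun t : ℝ => (t ^ 2) ^ n * ρ ^ ((n : ℝ) - p)) 1 := by fun_prop
    have h1 : ∀ᶠ t in 𝓝[<] (1 : ℝ), 1 < (t ^ 2) ^ n * ρ ^ ((n : ℝ) - p) :=
      nhdsWithin_le_nhds (hc.eventually (lt_mem_nhds (by simpa using hgap)))
    obtain ⟨t, h, ht⟩ := (h1.and (Ioo_mem_nhdsLT (zero_lt_one' ℝ))).exists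
    exact ⟨t, ht, h⟩
  set d : EuclideanSpace ℝ (Fin n) → EuclideanSpace ℝ (Fin n) := fun x => x₀ + t • (x - x₀)
    with hd
  have hdc : Continuous d := by fun_prop
  have hdΩ : ∀ x ∈ closure Ω, d x ∈ Ω := fun x hx => by
    have h := hΩc.combo_interior_closure_mem_interior (hΩo.interior_eq.symm ▸ hx₀) hx
      (sub_pos.mpr ht1) ht0.le (by ring)
    rw [hΩo.interior_eq] at h
    convert h using 1
    simp only [hd]
    module
  have hvd : ∀ x ∈ closure Ω, v (d x) < 0 := fun x hx => hvneg _ (hdΩ x hx)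
  have hcont : ContinuousOn (fun x => u x / v (d x)) (closure Ω) :=
    hu_cont.div ((hv2.continuousOn).comp hdc.continuousOn hdΩ) fun x hx => (hvd x hx).ne
  obtain ⟨x, hxc, hxmax⟩ := hΩb.isCompact_closure.exists_isMaxOn ⟨x₀, subset_closure hx₀⟩ hcont
  set η : ℝ := u x / v (d x) with hη
  have hηρ : ρ ≤ η := by
    have h := hxmax (subset_closure hx₀)
    simpa [hd, hρ, hη] using h
  have hη0 : 0 < η := by linarith
  have hx : x ∈ Ω := by
    by_contra hxΩ
    have hu := hubd x (hΩo.frontier_eq ▸ ⟨hxc, hxΩ⟩)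
    have := div_nonpos_of_nonneg_of_nonpos hu (hvd x hxc).le
    linarith
  have huη : u x = η * v (d x) := by rw [hη, div_mul_cancel₀ _ (hvd x hxc).ne]
  have hmin : ∀ z ∈ Ω, η * v (d z) ≤ u z := fun z hz => by
    have h : u z / v (d z) ≤ η := hxmax (subset_closure hz)
    rwa [div_le_iff_of_neg (hvd z (subset_closure hz))] at h
  have hy := hdΩ x hxc
  have hux : ContDiffAt ℝ 2 u x := hu2.contDiffAt (hΩo.mem_nhds hx)
  have hvy : ContDiffAt ℝ 2 v (d x) := hv2.contDiffAt (hΩo.mem_nhds hy)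
  have hbase : 0 < |v (d x)| + δ := by
    have := abs_pos.mpr (hvd x hxc).ne
    linarith
  have hdetv := hvsub _ hy
  have hdetv0 : 0 < hessianDet v (d x) := (Real.rpow_pos_of_pos hbase p).trans_le hdetv
  have hVpd : (hessianMatrix v (d x)).PosDef :=
    (hvconv.posSemidef_hessianMatrix hΩo hy hvy).posDef_iff_det_ne_zero.mpr hdetv0.ne'
  have hct : 0 < η * t ^ 2 := by positivity
  have hKpd : ((η * t ^ 2) • hessianMatrix v (d x)).PosDef := hVpd.smul hct
  have hsub : (hessianMatrix u x - (η * t ^ 2) • hessianMatrix v (d x)).PosSemidef := by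
    refine .of_dotProduct_mulVec_nonneg
      ((hessianMatrix_isHermitian hux).sub hKpd.isHermitian) fun w => ?_
    have hloc : IsLocalMin (fun τ : ℝ => u (x + τ • WithLp.toLp 2 w)
        + (-η) * v (d x + τ • t • WithLp.toLp 2 w)) 0 := by
      have hcl : Continuous fun τ : ℝ => x + τ • WithLp.toLp 2 w := by fun_prop
      filter_upwards [hcl.continuousAt.eventually
        (by simpa using hΩo.mem_nhds hx : ∀ᶠ z in 𝓝 (x + (0 : ℝ) • WithLp.toLp 2 w), z ∈ Ω)]
        with τ hτ
      have hdτ : d x + τ • t • WithLp.toLp 2 w = d (x + τ • WithLp.toLp 2 w) := by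
        simp only [hd]
        module
      have := hmin _ hτ
      rw [hdτ]
      simp only [zero_smul, add_zero]
      linarith
    have h := hloc.fderiv_fderiv_apply_nonneg hux hvy
    have h1 := dotProduct_hessianMatrix_mulVec hux (WithLp.toLp 2 w)
    have h2 := dotProduct_hessianMatrix_mulVec hvy (WithLp.toLp 2 w)
    simp only [map_smul, _root_.smul_apply, smul_eq_mul, ← h1, ← h2] at h
    simp only [star_trivial, sub_mulVec, smul_mulVec, dotProduct_sub, dotProduct_smul, smul_eq_mul]
    linarith
  have hdet := det_le_det_of_posDef_of_sub_posSemidef hKpd hsub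
  rw [det_smul, Fintype.card_fin] at hdet
  have hA : (|u x| + δ) ^ p ≤ η ^ p * (|v (d x)| + δ) ^ p := by
    rw [← Real.mul_rpow hη0.le hbase.le, huη, abs_mul, abs_of_pos hη0]
    refine Real.rpow_le_rpow (by positivity) ?_ hp0
    nlinarith
  have hchain : (η * t ^ 2) ^ n * (|v (d x)| + δ) ^ p ≤ η ^ p * (|v (d x)| + δ) ^ p :=
    calc (η * t ^ 2) ^ n * (|v (d x)| + δ) ^ p
        ≤ (η * t ^ 2) ^ n * hessianDet v (d x) := by gcongr
      _ ≤ hessianDet u x := hdet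
      _ ≤ _ := (husup x hx).trans hA
  have hle := le_of_mul_le_mul_right hchain (Real.rpow_pos_of_pos hbase p)
  have hηp := Real.rpow_pos_of_pos hη0 p
  have hsplit : η ^ n = η ^ ((n : ℝ) - p) * η ^ p := by
    rw [← Real.rpow_add hη0, sub_add_cancel, Real.rpow_natCast]
  rw [mul_pow, hsplit] at hle
  have hle' : (t ^ 2) ^ n * η ^ ((n : ℝ) - p) ≤ 1 := by
    refine le_of_mul_le_mul_right ?_ hηp
    linarith
  have hmono : ρ ^ ((n : ℝ) - p) ≤ η ^ ((n : ℝ) - p) :=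
    Real.rpow_le_rpow (by linarith) hηρ (by linarith)
  have := mul_le_mul_of_nonneg_left hmono (by positivity : (0 : ℝ) ≤ (t ^ 2) ^ n)
  linarith
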